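/- Let G be a finitely generated group acting transitively on a set X, let μ be the Haar probability measure on the compact group (ℤ/2ℤ)^X, fix p ∈ X and let A_p = {ω ∈ (ℤ/2ℤ)^X : ω_p = 0}. Then there exists a sequence of unit vectors f_n in L²((ℤ/2ℤ)^X, μ), each of which is a product of independent random variables (i.e., f_n(ω) = Π_{x∈X} f_{n,x}(ω_x) for functions f_{n,x} on ℤ/2ℤ), satisfying ‖g·f_n − f_n‖₂ → 0 for every g ∈ G and ‖f_n · χ_{A_p}‖₂ → 1, if and only if the action of G on X is recurrent. -/

import Mathlib

/-! ### Recurrence of Schreier graphs, via the capacity criterion -/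

/-- The Dirichlet energy of a finitely supported function `a : X → ℝ` with respect to
the Schreier graph of the action of `G` on `X` defined by a (finite, symmetric)
generating set `S`: the graph with vertex set `X` and an edge from `x` to `g • x` for
each `g ∈ S`. -/
noncomputable def schreierEnergy {G X : Type*} [Group G] [MulAction G X]
    (S : Finset G) (a : X →₀ ℝ) : ℝ :=
  ∑ᶠ x : X, ∑ g ∈ S, (a x - a (g • x)) ^ 2

/-- Recurrence of the simple random walk on the Schreier graph of the orbit of `x₀`
under the action of `G` (with respect to the finite symmetric generating set `S`),
expressed through the capacity criterion: the simple random walk on a connected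
locally finite graph is recurrent if and only if the capacity of a vertex `x₀`
vanishes, i.e. there exist finitely supported functions taking the value `1` at `x₀`
whose Dirichlet energy is arbitrarily small (Woess, "Random walks on infinite
graphs and groups", Theorem 2.12). -/
def SchreierRecurrentAt (G : Type*) {X : Type*} [Group G] [MulAction G X]
    (S : Finset G) (x₀ : X) : Prop :=
  ∀ ε : ℝ, 0 < ε → ∃ a : X →₀ ℝ,
    (a.support : Set X) ⊆ MulAction.orbit G x₀ ∧ a x₀ = 1 ∧ schreierEnergy S a < ε

/-- `S` is a finite symmetric generating set of `G`. -/
def IsSymmGen {G : Type*} [Group G] (S : Finset G) : Prop :=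
  (∀ g ∈ S, g⁻¹ ∈ S) ∧ Subgroup.closure (S : Set G) = ⊤

open MeasureTheory

/-- A function on `(ℤ/2ℤ)^X` is p.i.r. (a product of independent random variables)
if it is a finite product of functions each depending on a single coordinate, i.e. an
elementary tensor in `L²((ℤ/2ℤ)^X) = ⨂_X L²(ℤ/2ℤ)`. -/
def IsPIR {X : Type*} (f : (X → ZMod 2) → ℝ) : Prop :=
  ∃ (s : Finset X) (F : X → ZMod 2 → ℝ), ∀ ω : X → ZMod 2, f ω = ∏ x ∈ s, F x (ω x)

section CoordProd

variable {X : Type*}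

/-- The function `ω ↦ ∏ₓ H x (ω x)` on `(ℤ/2ℤ)^X`. -/
noncomputable def coordProd (H : X → ZMod 2 → ℝ) (ω : X → ZMod 2) : ℝ :=
  ∏ᶠ x, H x (ω x)

lemma hasFiniteMulSupport_apply {H : X → ZMod 2 → ℝ} (hH : H.HasFiniteMulSupport)
    (ω : X → ZMod 2) : (fun x => H x (ω x)).HasFiniteMulSupport :=
  hH.subset fun x hx h => hx (by simp [h])

lemma coordProd_eq_prod {H : X → ZMod 2 → ℝ} {s : Finset X} (hs : H.mulSupport ⊆ s)
    (ω : X → ZMod 2) : coordProd H ω = ∏ x ∈ s, H x (ω x) :=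
  finprod_eq_prod_of_mulSupport_subset _ fun _ hx => hs fun h => hx (by simp [h])

lemma coordProd_mul {H K : X → ZMod 2 → ℝ} (hH : H.HasFiniteMulSupport)
    (hK : K.HasFiniteMulSupport) (ω : X → ZMod 2) :
    coordProd (H * K) ω = coordProd H ω * coordProd K ω :=
  finprod_mul_distrib (hasFiniteMulSupport_apply hH ω) (hasFiniteMulSupport_apply hK ω)

lemma hasFiniteMulSupport_mul {H K : X → ZMod 2 → ℝ} (hH : H.HasFiniteMulSupport)
    (hK : K.HasFiniteMulSupport) : (H * K).HasFiniteMulSupport :=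
  (Set.Finite.union hH hK).subset (Function.mulSupport_mul H K)

lemma hasFiniteMulSupport_smul {G : Type*} [Group G] [MulAction G X] (g : G)
    {H : X → ZMod 2 → ℝ} (hH : H.HasFiniteMulSupport) :
    (fun x => H (g • x)).HasFiniteMulSupport :=
  Set.Finite.preimage (MulAction.injective g).injOn hH

lemma coordProd_comp_smul {G : Type*} [Group G] [MulAction G X] (g : G)
    (H : X → ZMod 2 → ℝ) (ω : X → ZMod 2) :
    coordProd H (fun x => ω (g • x)) = coordProd (fun x => H (g⁻¹ • x)) ω := by
  unfold coordProd
  rw [← finprod_comp_equiv (MulAction.toPerm g) (f := fun x => H (g⁻¹ • x) (ω x))]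
  simp

variable {μ : Measure (X → ZMod 2)} [IsProbabilityMeasure μ]

lemma measurable_prod_apply (H : X → ZMod 2 → ℝ) (s : Finset X) :
    Measurable fun ω : X → ZMod 2 => ∏ x ∈ s, H x (ω x) :=
  Finset.measurable_prod s fun x _ => (measurable_of_finite (H x)).comp (measurable_pi_apply x)

lemma abs_prod_apply_le (H : X → ZMod 2 → ℝ) (s : Finset X) (ω : X → ZMod 2) :
    |∏ x ∈ s, H x (ω x)| ≤ ∏ x ∈ s, (|H x 0| + |H x 1|) := by
  rw [Finset.abs_prod]
  refine Finset.prod_le_prod (fun _ _ => abs_nonneg _) fun x _ => ?_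
  generalize ω x = i
  fin_cases i
  · exact le_add_of_nonneg_right (abs_nonneg _)
  · exact le_add_of_nonneg_left (abs_nonneg _)

lemma integrable_prod_apply (H : X → ZMod 2 → ℝ) (s : Finset X) :
    Integrable (fun ω : X → ZMod 2 => ∏ x ∈ s, H x (ω x)) μ :=
  Integrable.of_bound (measurable_prod_apply H s).aestronglyMeasurable _
    (Filter.Eventually.of_forall (abs_prod_apply_le H s))

lemma integrable_coordProd {H : X → ZMod 2 → ℝ} (hH : H.HasFiniteMulSupport) :
    Integrable (coordProd H) μ := by
  have h : coordProd H = fun ω => ∏ x ∈ Set.Finite.toFinset hH, H x (ω x) :=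
    funext (coordProd_eq_prod (Set.Finite.coe_toFinset hH).ge)
  rw [h]
  exact integrable_prod_apply H _

lemma integral_prod_apply (hinv : ∀ v : X → ZMod 2, Measure.map (fun ω => v + ω) μ = μ)
    (H : X → ZMod 2 → ℝ) (s : Finset X) :
    ∫ ω, ∏ x ∈ s, H x (ω x) ∂μ = ∏ x ∈ s, (H x 0 + H x 1) / 2 := by
  classical
  induction s using Finset.induction_on with
  | empty => simp
  | insert p s hp ih =>
    set e : X → ZMod 2 := Pi.single p 1 with he
    have hmeas : Measurable fun ω : X → ZMod 2 => e + ω := measurable_pi_lambda _ fun x =>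
      (measurable_of_finite fun i : ZMod 2 => e x + i).comp (measurable_pi_apply x)
    have hshift : ∫ ω, ∏ x ∈ insert p s, H x (ω x) ∂μ =
        ∫ ω, ∏ x ∈ insert p s, H x ((e + ω) x) ∂μ := by
      conv_lhs => rw [← hinv e]
      exact integral_map hmeas.aemeasurable
        (measurable_prod_apply H (insert p s)).aestronglyMeasurable
    have hint : Integrable (fun ω : X → ZMod 2 => ∏ x ∈ insert p s, H x ((e + ω) x)) μ :=
      integrable_prod_apply (fun x i => H x (e x + i)) (insert p s)
    have hsum : ∫ ω, ∏ x ∈ insert p s, H x (ω x) ∂μ +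
        ∫ ω, ∏ x ∈ insert p s, H x ((e + ω) x) ∂μ =
        (H p 0 + H p 1) * ∫ ω, ∏ x ∈ s, H x (ω x) ∂μ := by
      rw [← integral_add (integrable_prod_apply H _) hint, ← integral_const_mul]
      refine integral_congr_ae (Filter.Eventually.of_forall fun ω => ?_)
      have hs : ∏ x ∈ s, H x ((e + ω) x) = ∏ x ∈ s, H x (ω x) :=
        Finset.prod_congr rfl fun x hx => by
          have : x ≠ p := fun h => hp (h ▸ hx)
          simp [he, this]
      simp only [Finset.prod_insert hp, hs]
      rw [← add_mul]
      congr 1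
      simp only [he, Pi.add_apply, Pi.single_eq_same]
      generalize ω p = i
      fin_cases i
      · rfl
      · exact add_comm _ _
    rw [Finset.prod_insert hp, ← ih]
    linarith

lemma integral_coordProd (hinv : ∀ v : X → ZMod 2, Measure.map (fun ω => v + ω) μ = μ)
    {H : X → ZMod 2 → ℝ} (hH : H.HasFiniteMulSupport) :
    ∫ ω, coordProd H ω ∂μ = ∏ᶠ x, (H x 0 + H x 1) / 2 := by
  have hs : H.mulSupport ⊆ Set.Finite.toFinset hH := (Set.Finite.coe_toFinset hH).ge
  simp_rw [coordProd_eq_prod hs]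
  rw [integral_prod_apply hinv, finprod_eq_prod_of_mulSupport_subset]
  exact fun _ hx => hs fun h => hx (by simp [h])

end CoordProd

section UnitProfile

variable {X : Type*}

/-- The families of unit vectors in `L²(ℤ/2ℤ)` almost all of which are constantly `1`. -/
structure IsUnitProfile (u : X → ZMod 2 → ℝ) : Prop where
  finite : u.HasFiniteMulSupport
  norm_eq : ∀ x, u x 0 ^ 2 + u x 1 ^ 2 = 2

/-- The inner product in `L²(ℤ/2ℤ)`. -/
noncomputable def coordInner (a b : ZMod 2 → ℝ) : ℝ := (a 0 * b 0 + a 1 * b 1) / 2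

lemma IsUnitProfile.smul {G : Type*} [Group G] [MulAction G X] (g : G)
    {u : X → ZMod 2 → ℝ} (hu : IsUnitProfile u) : IsUnitProfile fun x => u (g • x) :=
  ⟨hasFiniteMulSupport_smul g hu.finite, fun x => hu.norm_eq (g • x)⟩

lemma IsUnitProfile.abs_coordInner_le {u v : X → ZMod 2 → ℝ} (hu : IsUnitProfile u)
    (hv : IsUnitProfile v) (x : X) : |coordInner (u x) (v x)| ≤ 1 := by
  have h1 := hu.norm_eq x
  have h2 := hv.norm_eq x
  unfold coordInner
  rw [abs_le]
  constructor
  · nlinarith [sq_nonneg (u x 0 + v x 0), sq_nonneg (u x 1 + v x 1)]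
  · nlinarith [sq_nonneg (u x 0 - v x 0), sq_nonneg (u x 1 - v x 1)]

lemma IsUnitProfile.hasFiniteMulSupport_coordInner {u v : X → ZMod 2 → ℝ}
    (hu : IsUnitProfile u) (hv : IsUnitProfile v) :
    (fun x => coordInner (u x) (v x)).HasFiniteMulSupport :=
  (Set.Finite.union hu.finite hv.finite).subset fun x hx => by
    by_contra h
    simp only [Set.mem_union, Function.mem_mulSupport, not_or, not_not] at h
    exact hx (by norm_num [coordInner, h.1, h.2])

lemma IsUnitProfile.isPIR {u : X → ZMod 2 → ℝ} (hu : IsUnitProfile u) :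
    IsPIR (coordProd u) :=
  ⟨Set.Finite.toFinset hu.finite, u,
    coordProd_eq_prod (Set.Finite.coe_toFinset hu.finite).ge⟩

variable {μ : Measure (X → ZMod 2)} [IsProbabilityMeasure μ]

lemma IsUnitProfile.integral_mul
    (hinv : ∀ v : X → ZMod 2, Measure.map (fun ω => v + ω) μ = μ)
    {u v : X → ZMod 2 → ℝ} (hu : IsUnitProfile u) (hv : IsUnitProfile v) :
    ∫ ω, coordProd u ω * coordProd v ω ∂μ = ∏ᶠ x, coordInner (u x) (v x) := by
  simp_rw [← coordProd_mul hu.finite hv.finite]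
  exact integral_coordProd hinv (hasFiniteMulSupport_mul hu.finite hv.finite)

lemma IsUnitProfile.integrable_mul {u v : X → ZMod 2 → ℝ} (hu : IsUnitProfile u)
    (hv : IsUnitProfile v) : Integrable (fun ω => coordProd u ω * coordProd v ω) μ := by
  simp_rw [← coordProd_mul hu.finite hv.finite]
  exact integrable_coordProd (hasFiniteMulSupport_mul hu.finite hv.finite)

lemma IsUnitProfile.integral_sq
    (hinv : ∀ v : X → ZMod 2, Measure.map (fun ω => v + ω) μ = μ)
    {u : X → ZMod 2 → ℝ} (hu : IsUnitProfile u) : ∫ ω, coordProd u ω ^ 2 ∂μ = 1 := by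
  simp_rw [sq]
  rw [hu.integral_mul hinv hu]
  refine finprod_eq_one_of_forall_eq_one fun x => ?_
  have := hu.norm_eq x
  unfold coordInner
  linarith

lemma IsUnitProfile.integral_smul_sub_sq {G : Type*} [Group G] [MulAction G X]
    (hinv : ∀ v : X → ZMod 2, Measure.map (fun ω => v + ω) μ = μ)
    {u : X → ZMod 2 → ℝ} (hu : IsUnitProfile u) (g : G) :
    ∫ ω, (coordProd u (fun x => ω (g • x)) - coordProd u ω) ^ 2 ∂μ =
      2 - 2 * ∏ᶠ x, coordInner (u x) (u (g • x)) := by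
  have hv := hu.smul g⁻¹
  have hexp : ∀ ω, (coordProd u (fun x => ω (g • x)) - coordProd u ω) ^ 2 =
      coordProd (fun x => u (g⁻¹ • x)) ω * coordProd (fun x => u (g⁻¹ • x)) ω
        + coordProd u ω * coordProd u ω
        - 2 * (coordProd (fun x => u (g⁻¹ • x)) ω * coordProd u ω) := fun ω => by
    rw [coordProd_comp_smul]
    ring
  have h1 := hv.integral_sq hinv
  have h2 := hu.integral_sq hinv
  simp_rw [sq] at h1 h2
  have h3 : ∏ᶠ x, coordInner (u (g⁻¹ • x)) (u x) = ∏ᶠ x, coordInner (u x) (u (g • x)) := by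
    rw [← finprod_comp_equiv (MulAction.toPerm g)]
    simp
  simp_rw [hexp]
  have hadd := (hv.integrable_mul hv (μ := μ)).add (hu.integrable_mul hu)
  simp only [Pi.add_def] at hadd
  rw [integral_sub hadd ((hv.integrable_mul hu).const_mul 2), integral_add (hv.integrable_mul hv) (hu.integrable_mul hu), integral_const_mul,
    hv.integral_mul hinv hu, h1, h2, h3]
  norm_num

lemma IsUnitProfile.setIntegral_sq
    (hinv : ∀ v : X → ZMod 2, Measure.map (fun ω => v + ω) μ = μ)
    {u : X → ZMod 2 → ℝ} (hu : IsUnitProfile u) (p : X) :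
    ∫ ω in {ω : X → ZMod 2 | ω p = 0}, coordProd u ω ^ 2 ∂μ = u p 0 ^ 2 / 2 := by
  classical
  let K : X → ZMod 2 → ℝ := Pi.mulSingle p (Pi.single 0 1)
  have hK : K.HasFiniteMulSupport :=
    (Set.finite_singleton p).subset Pi.mulSupport_mulSingle_subset
  have hA : MeasurableSet {ω : X → ZMod 2 | ω p = 0} :=
    measurable_pi_apply p (measurableSet_singleton 0)
  have hKp : K p = Pi.single 0 1 := Pi.mulSingle_eq_same p _
  have hKne : ∀ x, x ≠ p → K x = 1 := fun x hx => Pi.mulSingle_eq_of_ne hx _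
  have hu2 := hasFiniteMulSupport_mul hu.finite hu.finite
  have hind : ∀ ω, Set.indicator {ω : X → ZMod 2 | ω p = 0} (fun ω => coordProd u ω ^ 2) ω =
      coordProd (u * u * K) ω := fun ω => by
    rw [coordProd_mul hu2 hK, coordProd_mul hu.finite hu.finite, ← sq]
    have : coordProd K ω = K p (ω p) :=
      finprod_eq_single _ p fun x hx => by simp [hKne x hx]
    rw [this, hKp]
    by_cases h : ω p = 0
    · simp [Set.indicator, h]
    · simp [Set.indicator, h]
  rw [← integral_indicator hA]
  simp_rw [hind]
  rw [integral_coordProd hinv (hasFiniteMulSupport_mul hu2 hK), finprod_eq_single _ p]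
  · simp [hKp, sq]
  · intro x hx
    have := hu.norm_eq x
    simp only [Pi.mul_apply, hKne x hx, Pi.one_apply]
    linarith

/-- The absolute value of a unit p.i.r. function is the product of a nonnegative profile. -/
lemma IsPIR.exists_isUnitProfile
    (hinv : ∀ v : X → ZMod 2, Measure.map (fun ω => v + ω) μ = μ)
    {f : (X → ZMod 2) → ℝ} (hf : IsPIR f) (hnorm : ∫ ω, f ω ^ 2 ∂μ = 1) :
    ∃ u : X → ZMod 2 → ℝ, IsUnitProfile u ∧ (∀ x i, 0 ≤ u x i) ∧
      ∀ ω, |f ω| = coordProd u ω := by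
  classical
  obtain ⟨s, F, hF⟩ := hf
  let N : X → ℝ := fun x => (F x 0 ^ 2 + F x 1 ^ 2) / 2
  have hN : ∏ x ∈ s, N x = 1 := by
    rw [← hnorm]
    simp_rw [hF, ← Finset.prod_pow]
    exact (integral_prod_apply hinv (fun x i => F x i ^ 2) s).symm
  have hNpos : ∀ x ∈ s, 0 < N x := fun x hx => by
    have h0 : N x ≠ 0 := fun h => by simp [Finset.prod_eq_zero hx h] at hN
    exact lt_of_le_of_ne (by positivity) h0.symm
  let u : X → ZMod 2 → ℝ := fun x i => if x ∈ s then |F x i| / √(N x) else 1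
  have hsupp : u.mulSupport ⊆ s := fun x hx => by
    by_contra h
    exact hx (funext fun i => if_neg h)
  refine ⟨u, ⟨s.finite_toSet.subset hsupp, fun x => ?_⟩, fun x i => ?_, fun ω => ?_⟩
  · by_cases hx : x ∈ s
    · have := hNpos x hx
      simp only [u, if_pos hx, div_pow, sq_abs, Real.sq_sqrt this.le]
      rw [← add_div, div_eq_iff this.ne']
      simp only [N]
      ring
    · norm_num [u, hx]
  · simp only [u]
    split_ifs <;> positivity
  · rw [coordProd_eq_prod hsupp, hF, Finset.abs_prod]
    have : ∏ x ∈ s, u x (ω x) = ∏ x ∈ s, |F x (ω x)| / √(N x) :=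
      Finset.prod_congr rfl fun x hx => if_pos hx
    rw [this, Finset.prod_div_distrib, ← Real.sqrt_prod s fun x hx => (hNpos x hx).le, hN]
    simp

end UnitProfile

section Energy

variable {G X : Type*} [Group G] [MulAction G X]

/-- The squared `ℓ²`-distance between `a` and its translate by `g`. -/
noncomputable def translateEnergy (g : G) (a : X →₀ ℝ) : ℝ :=
  ∑ᶠ x, (a x - a (g • x)) ^ 2

lemma finite_translate_support (g : G) (a : X →₀ ℝ) :
    (fun x => (a x - a (g • x)) ^ 2).HasFiniteSupport := by
  refine (Set.Finite.union a.hasFiniteSupport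
    (Set.Finite.preimage (MulAction.injective g).injOn a.hasFiniteSupport)).subset fun x hx => ?_
  by_contra h
  simp only [Set.mem_union, Set.mem_preimage, Function.mem_support, not_or, not_not] at h
  exact hx (by simp [h.1, h.2])

lemma translateEnergy_nonneg (g : G) (a : X →₀ ℝ) : 0 ≤ translateEnergy g a :=
  finsum_nonneg fun _ => sq_nonneg _

lemma schreierEnergy_eq_sum (S : Finset G) (a : X →₀ ℝ) :
    schreierEnergy S a = ∑ g ∈ S, translateEnergy g a :=
  finsum_sum_comm S _ fun g _ => finite_translate_support g a

lemma schreierEnergy_nonneg (S : Finset G) (a : X →₀ ℝ) : 0 ≤ schreierEnergy S a :=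
  finsum_nonneg fun _ => Finset.sum_nonneg fun _ _ => sq_nonneg _

lemma schreierEnergy_smul (S : Finset G) (c : ℝ) (a : X →₀ ℝ) :
    schreierEnergy S (c • a) = c ^ 2 * schreierEnergy S a := by
  unfold schreierEnergy
  rw [mul_finsum]
  refine finsum_congr fun x => ?_
  rw [Finset.mul_sum]
  refine Finset.sum_congr rfl fun g _ => ?_
  simp only [Finsupp.smul_apply, smul_eq_mul]
  ring

lemma translateEnergy_le_schreierEnergy {S : Finset G} {g : G} (hg : g ∈ S) (a : X →₀ ℝ) :
    translateEnergy g a ≤ schreierEnergy S a := by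
  rw [schreierEnergy_eq_sum]
  exact Finset.single_le_sum (f := fun g => translateEnergy g a)
    (fun g _ => translateEnergy_nonneg g a) hg

lemma translateEnergy_inv (g : G) (a : X →₀ ℝ) :
    translateEnergy g⁻¹ a = translateEnergy g a := by
  unfold translateEnergy
  rw [← finsum_comp_equiv (MulAction.toPerm g)]
  simp only [MulAction.toPerm_apply, inv_smul_smul]
  exact finsum_congr fun x => by ring

lemma translateEnergy_mul_le (g h : G) (a : X →₀ ℝ) :
    translateEnergy (g * h) a ≤ 2 * translateEnergy g a + 2 * translateEnergy h a := by
  have hg : (fun x => (a (h • x) - a (g • h • x)) ^ 2).HasFiniteSupport :=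
    Set.Finite.preimage (MulAction.injective h).injOn (finite_translate_support g a)
  have hg' : translateEnergy g a = ∑ᶠ x, (a (h • x) - a (g • h • x)) ^ 2 :=
    (finsum_comp_equiv (MulAction.toPerm h)).symm
  have hh := finite_translate_support h a
  have hfin : (fun x => 2 * (a (h • x) - a (g • h • x)) ^ 2).HasFiniteSupport :=
    Set.Finite.subset hg fun x hx h => hx (by simp_all)
  have hfin' : (fun x => 2 * (a x - a (h • x)) ^ 2).HasFiniteSupport :=
    Set.Finite.subset hh fun x hx h => hx (by simp_all)
  rw [hg', translateEnergy, translateEnergy, mul_finsum, mul_finsum,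
    ← finsum_add_distrib hfin hfin']
  refine finsum_le_finsum' (finite_translate_support (g * h) a)
    ((Set.Finite.union hfin hfin').subset (Function.support_add _ _)) fun x => ?_
  simp only [mul_smul]
  nlinarith [sq_nonneg ((a x - a (h • x)) - (a (h • x) - a (g • h • x)))]

lemma exists_translateEnergy_le {S : Finset G} (hS : Subgroup.closure (S : Set G) = ⊤) (g : G) :
    ∃ C : ℝ, ∀ a : X →₀ ℝ, translateEnergy g a ≤ C * schreierEnergy S a := by
  have hg : g ∈ Subgroup.closure (S : Set G) := hS ▸ Subgroup.mem_top g
  induction hg using Subgroup.closure_induction with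
  | mem g hg => exact ⟨1, fun a => by simpa using translateEnergy_le_schreierEnergy hg a⟩
  | one => exact ⟨0, fun a => by simp [translateEnergy]⟩
  | mul g h _ _ ihg ihh =>
    obtain ⟨C, hC⟩ := ihg
    obtain ⟨D, hD⟩ := ihh
    refine ⟨2 * C + 2 * D, fun a => ?_⟩
    linarith [translateEnergy_mul_le g h a, hC a, hD a]
  | inv g _ ih =>
    obtain ⟨C, hC⟩ := ih
    exact ⟨C, fun a => by rw [translateEnergy_inv]; exact hC a⟩

end Energy

section Comparison

lemma one_sub_prod_le_sum {ι : Type*} (s : Finset ι) (c : ι → ℝ) (hc : ∀ i, |c i| ≤ 1) :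
    1 - ∏ i ∈ s, c i ≤ ∑ i ∈ s, (1 - c i) := by
  classical
  induction s using Finset.induction_on with
  | empty => simp
  | insert j s hj ih =>
    rw [Finset.prod_insert hj, Finset.sum_insert hj]
    have h1 := abs_le.1 (hc j)
    have h2 : ∏ i ∈ s, c i ≤ 1 := (le_abs_self _).trans <| by
      rw [Finset.abs_prod]
      exact Finset.prod_le_one (fun _ _ => abs_nonneg _) fun i _ => hc i
    nlinarith

/-- If numbers in `[0, 1]` have product close to `1`, then they are summably close to `1`. -/
lemma sum_one_sub_mul_prod_le {ι : Type*} (s : Finset ι) (c : ι → ℝ) (hc : ∀ i, 0 ≤ c i) :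
    (1 + ∑ i ∈ s, (1 - c i)) * ∏ i ∈ s, c i ≤ 1 := by
  have h0 : 0 ≤ ∏ i ∈ s, c i := Finset.prod_nonneg fun i _ => hc i
  have h1 : ∏ i ∈ s, c i ≤ Real.exp (-∑ i ∈ s, (1 - c i)) := by
    rw [← Finset.sum_neg_distrib, Real.exp_sum]
    refine Finset.prod_le_prod (fun i _ => hc i) fun i _ => ?_
    linarith [Real.add_one_le_exp (-(1 - c i))]
  calc _ ≤ Real.exp (∑ i ∈ s, (1 - c i)) * Real.exp (-∑ i ∈ s, (1 - c i)) := by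
        refine mul_le_mul ?_ h1 h0 (Real.exp_pos _).le
        linarith [Real.add_one_le_exp (∑ i ∈ s, (1 - c i))]
    _ = 1 := by rw [← Real.exp_add]; simp

variable {G X : Type*} [Group G] [MulAction G X]
  {μ : Measure (X → ZMod 2)} [IsProbabilityMeasure μ]

/-- The coordinate `u x 0 - 1` of a unit profile `u`, as a finitely supported function. -/
noncomputable def IsUnitProfile.toFinsupp {u : X → ZMod 2 → ℝ} (hu : IsUnitProfile u) : X →₀ ℝ :=
  Finsupp.ofSupportFinite (fun x => u x 0 - 1) <|
    hu.finite.subset fun x hx h => hx (by simp [h])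

lemma IsUnitProfile.translateEnergy_toFinsupp_le
    (hinv : ∀ v : X → ZMod 2, Measure.map (fun ω => v + ω) μ = μ)
    {u : X → ZMod 2 → ℝ} (hu : IsUnitProfile u) (hpos : ∀ x i, 0 ≤ u x i) (g : G)
    (hle : ∫ ω, (coordProd u (fun x => ω (g • x)) - coordProd u ω) ^ 2 ∂μ ≤ 1) :
    translateEnergy g hu.toFinsupp ≤
      4 * ∫ ω, (coordProd u (fun x => ω (g • x)) - coordProd u ω) ^ 2 ∂μ := by
  rw [hu.integral_smul_sub_sq hinv] at hle ⊢
  have hfin := hu.hasFiniteMulSupport_coordInner (hu.smul g)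
  have hc : ∀ x, 0 ≤ coordInner (u x) (u (g • x)) := fun x =>
    div_nonneg (add_nonneg (mul_nonneg (hpos _ _) (hpos _ _))
      (mul_nonneg (hpos _ _) (hpos _ _))) zero_le_two
  have hfin' := finite_translate_support g hu.toFinsupp
  let s : Finset X := (Set.Finite.union hfin hfin').toFinset
  have hprod : ∏ᶠ x, coordInner (u x) (u (g • x)) = ∏ x ∈ s, coordInner (u x) (u (g • x)) :=
    finprod_eq_prod_of_mulSupport_subset _ (by simp [s])
  have hsum : translateEnergy g hu.toFinsupp ≤
      4 * ∑ x ∈ s, (1 - coordInner (u x) (u (g • x))) := by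
    rw [translateEnergy, finsum_eq_sum_of_support_subset (s := s) _ (by simp [s]),
      Finset.mul_sum]
    refine Finset.sum_le_sum fun x _ => ?_
    have h1 := hu.norm_eq x
    have h2 := hu.norm_eq (g • x)
    change (u x 0 - 1 - (u (g • x) 0 - 1)) ^ 2 ≤ _
    unfold coordInner
    nlinarith [sq_nonneg (u x 1 - u (g • x) 1)]
  have hmain := sum_one_sub_mul_prod_le s (fun x => coordInner (u x) (u (g • x))) hc
  have hT : 0 ≤ ∑ x ∈ s, (1 - coordInner (u x) (u (g • x))) :=
    Finset.sum_nonneg fun x _ =>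
      sub_nonneg.2 (abs_le.1 (hu.abs_coordInner_le (hu.smul g) x)).2
  rw [hprod] at hle ⊢
  nlinarith

/-- The family of unit vectors in `L²(ℤ/2ℤ)` moving from the constant `1`, where `a` vanishes,
to the normalized indicator of `0`, where `a` equals `1`. -/
noncomputable def rotationProfile (a : X → ℝ) (x : X) (i : ZMod 2) : ℝ :=
  √2 * if i = 0 then Real.cos (Real.pi / 4 * (1 - a x)) else Real.sin (Real.pi / 4 * (1 - a x))

lemma isUnitProfile_rotationProfile (a : X →₀ ℝ) : IsUnitProfile (rotationProfile a) := by
  refine ⟨a.hasFiniteSupport.subset fun x hx h => hx (funext fun i => ?_), fun x => ?_⟩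
  · have : √2 * (√2 / 2) = 1 := by
      rw [← mul_div_assoc, Real.mul_self_sqrt zero_le_two]; norm_num
    simp [rotationProfile, h, this]
  · simp only [rotationProfile, mul_pow, Real.sq_sqrt zero_le_two, if_true, one_ne_zero,
      if_false]
    rw [← mul_add, Real.cos_sq_add_sin_sq, mul_one]

lemma coordInner_rotationProfile (a : X → ℝ) (x y : X) :
    coordInner (rotationProfile a x) (rotationProfile a y) =
      Real.cos (Real.pi / 4 * (a x - a y)) := by
  have h : Real.pi / 4 * (a x - a y) =
      Real.pi / 4 * (1 - a y) - Real.pi / 4 * (1 - a x) := by ring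
  rw [h, Real.cos_sub]
  simp only [coordInner, rotationProfile, if_true, one_ne_zero, if_false]
  linear_combination (Real.cos (Real.pi / 4 * (1 - a x)) * Real.cos (Real.pi / 4 * (1 - a y)) +
    Real.sin (Real.pi / 4 * (1 - a x)) * Real.sin (Real.pi / 4 * (1 - a y))) / 2 *
    Real.mul_self_sqrt (zero_le_two (α := ℝ))

lemma integral_rotationProfile_smul_sub_sq_le
    (hinv : ∀ v : X → ZMod 2, Measure.map (fun ω => v + ω) μ = μ) (a : X →₀ ℝ) (g : G) :
    ∫ ω, (coordProd (rotationProfile a) (fun x => ω (g • x)) -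
      coordProd (rotationProfile a) ω) ^ 2 ∂μ ≤ translateEnergy g a := by
  have hu := isUnitProfile_rotationProfile a
  rw [hu.integral_smul_sub_sq hinv]
  have hfin := finite_translate_support g a
  simp_rw [coordInner_rotationProfile]
  let s : Finset X := Set.Finite.toFinset hfin
  have hprod : ∏ᶠ x, Real.cos (Real.pi / 4 * (a x - a (g • x))) =
      ∏ x ∈ s, Real.cos (Real.pi / 4 * (a x - a (g • x))) :=
    finprod_eq_prod_of_mulSupport_subset _ fun x hx => by
      by_contra hxs
      have h : (a x - a (g • x)) ^ 2 = 0 := by simpa [s] using hxs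
      exact hx (by simp [pow_eq_zero_iff two_ne_zero |>.1 h])
  have hsum : 2 * ∑ x ∈ s, (1 - Real.cos (Real.pi / 4 * (a x - a (g • x)))) ≤
      translateEnergy g a := by
    rw [translateEnergy, finsum_eq_sum_of_support_subset (s := s) _ (by simp [s]),
      Finset.mul_sum]
    refine Finset.sum_le_sum fun x _ => ?_
    have h1 := Real.one_sub_sq_div_two_le_cos (x := Real.pi / 4 * (a x - a (g • x)))
    have h2 : (Real.pi / 4) ^ 2 ≤ 1 :=
      pow_le_one₀ (by positivity) (by linarith [Real.pi_le_four])
    rw [mul_pow] at h1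
    nlinarith [sq_nonneg (a x - a (g • x))]
  have := one_sub_prod_le_sum s (fun x => Real.cos (Real.pi / 4 * (a x - a (g • x))))
    fun x => Real.abs_cos_le_one _
  rw [hprod]
  linarith

lemma integral_abs_smul_sub_sq_le {f : (X → ZMod 2) → ℝ} (hf : IsPIR f) (g : G) :
    ∫ ω, (|f (fun x => ω (g • x))| - |f ω|) ^ 2 ∂μ ≤
      ∫ ω, (f (fun x => ω (g • x)) - f ω) ^ 2 ∂μ := by
  refine integral_mono_of_nonneg (Filter.Eventually.of_forall fun ω => sq_nonneg _) ?_
    (Filter.Eventually.of_forall fun ω => sq_le_sq.2 (abs_abs_sub_abs_le _ _))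
  obtain ⟨s, F, hF⟩ := hf
  have hmeas : Measurable fun ω : X → ZMod 2 => f fun x => ω (g • x) := by
    simp_rw [hF]
    exact Finset.measurable_prod s fun x _ =>
      (measurable_of_finite (F x)).comp (measurable_pi_apply (g • x))
  have hmeas' : Measurable f := by
    rw [funext hF]
    exact measurable_prod_apply F s
  obtain ⟨B, hB⟩ : ∃ B, ∀ ω, |f ω| ≤ B := by
    simp_rw [hF]
    exact ⟨_, abs_prod_apply_le F s⟩
  refine Integrable.of_bound ((hmeas.sub hmeas').pow_const 2).aestronglyMeasurable ((B + B) ^ 2)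
    (Filter.Eventually.of_forall fun ω => ?_)
  rw [Real.norm_eq_abs, abs_pow]
  exact pow_le_pow_left₀ (abs_nonneg _) ((abs_sub _ _).trans (add_le_add (hB _) (hB _))) 2

end Comparison

/-- **Theorem 2.9.** Let `G` be a finitely generated group (with finite symmetric
generating set `S`) acting transitively on a set `X`, let `μ` be the Haar probability
measure on the compact group `(ℤ/2ℤ)^X` (characterized as a translation-invariant
probability measure), fix `p ∈ X`, and let `A_p = {ω : ω_p = 0}`.  There exists a
sequence of p.i.r. unit vectors `f n` in `L²((ℤ/2ℤ)^X, μ)` with `‖g·f n - f n‖₂ → 0`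
for every `g ∈ G` (where `(g·f)(ω) = f(g⁻¹·ω)` and `(g·ω)(x) = ω(g⁻¹ • x)`) and
`‖f n · χ_{A_p}‖₂ → 1`, if and only if the action of `G` on `X` is recurrent. -/
theorem stmt6 {G X : Type*} [Group G] [MulAction G X] [MulAction.IsPretransitive G X]
    (S : Finset G) (hS : IsSymmGen S)
    (μ : Measure (X → ZMod 2)) [IsProbabilityMeasure μ]
    (hinv : ∀ v : X → ZMod 2, Measure.map (fun ω => v + ω) μ = μ)
    (p : X) :
    (∃ f : ℕ → (X → ZMod 2) → ℝ,
      (∀ n, IsPIR (f n)) ∧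
      (∀ n, ∫ ω, (f n ω) ^ 2 ∂μ = 1) ∧
      (∀ g : G, Filter.Tendsto
        (fun n => ∫ ω, (f n (fun x => ω (g • x)) - f n ω) ^ 2 ∂μ)
        Filter.atTop (nhds 0)) ∧
      Filter.Tendsto (fun n => ∫ ω in {ω : X → ZMod 2 | ω p = 0}, (f n ω) ^ 2 ∂μ)
        Filter.atTop (nhds 1)) ↔
    SchreierRecurrentAt G S p := by
  constructor
  · rintro ⟨f, hpir, hnorm, hmove, hset⟩ ε hε
    choose u hu hpos habs using fun n => (hpir n).exists_isUnitProfile hinv (hnorm n)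
    have hsum : Filter.Tendsto
        (fun n => ∑ g ∈ S, ∫ ω, (f n (fun x => ω (g • x)) - f n ω) ^ 2 ∂μ)
        Filter.atTop (nhds 0) := by
      simpa using tendsto_finsetSum S fun g _ => hmove g
    have hδ : (0 : ℝ) < min 1 (ε / 50) := lt_min one_pos (by positivity)
    obtain ⟨n, hn, hp⟩ := ((hsum.eventually (gt_mem_nhds hδ)).and
      (hset.eventually (lt_mem_nhds (show (0.9 : ℝ) < 1 by norm_num)))).exists
    have hD : ∀ g : G, ∫ ω, (coordProd (u n) (fun x => ω (g • x)) - coordProd (u n) ω) ^ 2 ∂μ ≤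
        ∫ ω, (f n (fun x => ω (g • x)) - f n ω) ^ 2 ∂μ := fun g => by
      simp_rw [← habs n]
      exact integral_abs_smul_sub_sq_le (hpir n) g
    have hE : schreierEnergy S (hu n).toFinsupp ≤
        4 * ∑ g ∈ S, ∫ ω, (f n (fun x => ω (g • x)) - f n ω) ^ 2 ∂μ := by
      rw [schreierEnergy_eq_sum, Finset.mul_sum]
      refine Finset.sum_le_sum fun g hg => ?_
      have h1 : ∫ ω, (f n (fun x => ω (g • x)) - f n ω) ^ 2 ∂μ ≤ 1 :=
        (Finset.single_le_sum
          (f := fun g => ∫ ω, (f n (fun x => ω (g • x)) - f n ω) ^ 2 ∂μ)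
          (fun g _ => integral_nonneg fun ω => sq_nonneg _) hg).trans
          (hn.le.trans (min_le_left _ _))
      linarith [(hu n).translateEnergy_toFinsupp_le hinv (hpos n) g ((hD g).trans h1), hD g]
    have hup : 0.3 < u n p 0 - 1 := by
      simp_rw [← sq_abs (f n _), habs n] at hp
      rw [(hu n).setIntegral_sq hinv p] at hp
      nlinarith [hpos n p 0]
    refine ⟨(u n p 0 - 1)⁻¹ • (hu n).toFinsupp, fun x _ => MulAction.exists_smul_eq G p x,
      inv_mul_cancel₀ (by linarith), ?_⟩
    rw [schreierEnergy_smul, inv_pow, ← div_eq_inv_mul, div_lt_iff₀ (by positivity)]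
    have hlt := hn.trans_le (min_le_right 1 (ε / 50))
    have hsq : 0.09 < (u n p 0 - 1) ^ 2 := by nlinarith
    nlinarith
  · intro hrec
    choose a _ hap hE using fun n : ℕ => hrec (1 / ((n : ℝ) + 1)) Nat.one_div_pos_of_nat
    refine ⟨fun n => coordProd (rotationProfile (a n)),
      fun n => (isUnitProfile_rotationProfile (a n)).isPIR,
      fun n => (isUnitProfile_rotationProfile (a n)).integral_sq hinv, fun g => ?_, ?_⟩
    · obtain ⟨C, hC⟩ := exists_translateEnergy_le (X := X) hS.2 g
      have hE0 : Filter.Tendsto (fun n => schreierEnergy S (a n)) Filter.atTop (nhds 0) :=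
        squeeze_zero (fun n => schreierEnergy_nonneg S (a n)) (fun n => (hE n).le)
          tendsto_one_div_add_atTop_nhds_zero_nat
      refine squeeze_zero (fun n => integral_nonneg fun ω => sq_nonneg _)
        (fun n => (integral_rotationProfile_smul_sub_sq_le hinv (a n) g).trans (hC (a n))) ?_
      simpa using hE0.const_mul C
    · have h : ∀ n, ∫ ω in {ω : X → ZMod 2 | ω p = 0},
          coordProd (rotationProfile (a n)) ω ^ 2 ∂μ = 1 := fun n => by
        rw [(isUnitProfile_rotationProfile (a n)).setIntegral_sq hinv p]
        simp [rotationProfile, hap n]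
      simp_rw [h]
      exact tendsto_const_nhds
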